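/- Let d ≥ 1, r ∈ ℤ, ω = exp(2πi/d), and let a, b be unitary complex matrices of the same size with a^d = 1, b^d = 1, and a·b = ω·b·a. Set Λ = exp(πi(d+1)/d)·a·b^† and U = (1/√d)·∑_{m=0}^{d−1} exp(π·i·m·(m+2r+d)/d)·Λ^m. Then U is unitary (U·U^† = 1), and conjugation by U acts as: U·a·U^† = ω^{−r}·b and U·b·U^† = ω^{1−r}·a^†·b². -/

import Mathlib

open Complex Matrix

lemma aux_shift {M : Type*} [AddCommGroup M] (f : ℕ → M) (d : ℕ) (hf : ∀ m, f (m + d) = f m)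
    (n : ℕ) : ∑ m ∈ Finset.range d, f (m + n) = ∑ m ∈ Finset.range d, f m := by
  induction n with
  | zero => simp
  | succ n ih =>
    rw [← ih]
    have h1 := Finset.sum_range_succ (fun m => f (m + n)) d
    have h2 := Finset.sum_range_succ' (fun m => f (m + n)) d
    rw [h1] at h2
    have h3 : f (d + n) = f (0 + n) := by rw [add_comm d n, hf, zero_add]
    simp only [h3] at h2
    have h4 := add_right_cancel h2
    rw [h4]
    refine Finset.sum_congr rfl fun m _ => ?_
    congr 1
    omega

lemma aux_comm {ι : Type*} [Fintype ι] [DecidableEq ι] (ω : ℂ) (x y : Matrix ι ι ℂ)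
    (h : x * y = ω • (y * x)) (n : ℕ) : x ^ n * y = ω ^ n • (y * x ^ n) := by
  induction n with
  | zero => simp
  | succ n ih =>
    rw [pow_succ, mul_assoc, h, mul_smul_comm, ← mul_assoc, ih, smul_mul_assoc, smul_smul,
      mul_assoc, pow_succ ω, mul_comm ω]

lemma aux_pow {ι : Type*} [Fintype ι] [DecidableEq ι] (d : ℕ) (hd : (d : ℂ) ≠ 0)
    (x y : Matrix ι ι ℂ)
    (h : x * y = Complex.exp (2 * Real.pi * Complex.I / d) • (y * x)) (n : ℕ) :
    (y * x) ^ n = Complex.exp (Real.pi * Complex.I * n * (n - 1) / d) • (y ^ n * x ^ n) := by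
  induction n with
  | zero => simp
  | succ n ih =>
    rw [pow_succ, ih, smul_mul_assoc]
    have : y ^ n * x ^ n * (y * x) =
        Complex.exp (2 * Real.pi * Complex.I / d) ^ n • (y ^ (n+1) * x ^ (n+1)) := by
      rw [mul_assoc, ← mul_assoc (x ^ n), aux_comm _ x y h, smul_mul_assoc, mul_smul_comm,
        pow_succ, pow_succ]
      simp only [mul_assoc]
    rw [this, smul_smul, ← Complex.exp_nat_mul, ← Complex.exp_add]
    congr 2
    push_cast
    field_simp
    ring

/-- let `a, b` be unitary matrices of the same size with `a^d = 1`, `b^d = 1`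
and `a b = ω b a` where `ω = exp(2πi/d)`, `d ≥ 1`. Set `Λ = e^{πi(d+1)/d} a bᴴ` and
`U = (1/√d) ∑_{m=0}^{d-1} exp(π i m (m+2r+d)/d) Λ^m`. Then `U` is unitary and
`U a Uᴴ = ω^{-r} b`, `U b Uᴴ = ω^{1-r} aᴴ b²`. -/
theorem statement12 {ι : Type*} [Fintype ι] [DecidableEq ι] (d : ℕ) (hd : 1 ≤ d) (r : ℤ)
    (ω : ℂ) (hω : ω = Complex.exp (2 * Real.pi * Complex.I / d))
    (a b : Matrix ι ι ℂ)
    (ha : a * aᴴ = 1 ∧ aᴴ * a = 1) (hb : b * bᴴ = 1 ∧ bᴴ * b = 1)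
    (had : a ^ d = 1) (hbd : b ^ d = 1)
    (hab : a * b = ω • (b * a))
    (Λ U : Matrix ι ι ℂ)
    (hΛ : Λ = Complex.exp (Real.pi * Complex.I * (d + 1) / d) • (a * bᴴ))
    (hU : U = ((Real.sqrt d : ℂ))⁻¹ •
      ∑ m ∈ Finset.range d,
        Complex.exp (Real.pi * Complex.I * m * (m + 2 * r + d) / d) • Λ ^ m) :
    (U * Uᴴ = 1 ∧ Uᴴ * U = 1) ∧
    U * a * Uᴴ = ω ^ (-r) • b ∧
    U * b * Uᴴ = ω ^ (1 - r) • (aᴴ * b ^ 2) := by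
  have hd0 : (d : ℂ) ≠ 0 := by exact_mod_cast (by omega : d ≠ 0)
  have hprim : IsPrimitiveRoot ω d := by
    rw [hω]; exact Complex.isPrimitiveRoot_exp d (by omega)
  have hω0 : ω ≠ 0 := by rw [hω]; exact Complex.exp_ne_zero _
  obtain ⟨ha1, ha2⟩ := ha
  obtain ⟨hb1, hb2⟩ := hb
  -- commutation relations
  have hba : bᴴ * a = ω • (a * bᴴ) := by
    have := congrArg (fun z => bᴴ * z * bᴴ) hab
    simp only [mul_smul_comm, smul_mul_assoc] at this
    rw [mul_assoc, mul_assoc a, hb1, mul_one, ← mul_assoc bᴴ b, hb2, one_mul] at this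
    exact this
  have hba2 : b * aᴴ = ω • (aᴴ * b) := by
    have := congrArg (fun z => aᴴ * z * aᴴ) hab
    simp only [mul_smul_comm, smul_mul_assoc] at this
    rw [← mul_assoc aᴴ a, ha2, one_mul, mul_assoc aᴴ, mul_assoc b, ha1, mul_one] at this
    exact this
  set p : ℂ := Complex.exp (Real.pi * Complex.I * (d + 1) / d) with hp
  have hpc : (starRingEnd ℂ) p * p = 1 := by
    rw [hp, ← Complex.exp_conj, ← Complex.exp_add, ← Complex.exp_zero]
    congr 1
    simp
    ring
  have hp2 : (starRingEnd ℂ) p * (starRingEnd ℂ) p * ω = 1 := by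
    rw [hp, hω, ← Complex.exp_conj, ← Complex.exp_add, ← Complex.exp_add, Complex.exp_eq_one_iff]
    refine ⟨-1, ?_⟩
    simp
    field_simp
    ring
  have hΛH : Λᴴ = (starRingEnd ℂ) p • (b * aᴴ) := by
    rw [hΛ, conjTranspose_smul, conjTranspose_mul, conjTranspose_conjTranspose]; rfl
  have hLL : Λᴴ * Λ = 1 := by
    rw [hΛH, hΛ, smul_mul_smul_comm, hpc, one_smul, mul_assoc, ← mul_assoc aᴴ, ha2, one_mul, hb1]
  have hLL' : Λ * Λᴴ = 1 := mul_eq_one_comm.mp hLL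
  have hΛd : Λ ^ d = 1 := by
    have hbHd : bᴴ ^ d = 1 := by rw [← conjTranspose_pow, hbd, conjTranspose_one]
    rw [hΛ, smul_pow, aux_pow d hd0 bᴴ a (by rw [← hω]; exact hba), had, hbHd, one_mul, smul_smul,
      hp, ← Complex.exp_nat_mul, ← Complex.exp_add]
    have : Complex.exp (d * (Real.pi * Complex.I * (d + 1) / d) +
        Real.pi * Complex.I * d * (d - 1) / d) = 1 := by
      rw [Complex.exp_eq_one_iff]
      refine ⟨d, ?_⟩
      push_cast
      field_simp
      ring
    rw [this, one_smul]
  -- coefficients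
  set c : ℕ → ℂ := fun m => Complex.exp (Real.pi * Complex.I * m * (m + 2 * r + d) / d) with hc
  have hcper : ∀ m, c (m + d) = c m := by
    intro m
    simp only [hc]
    rw [Complex.exp_eq_exp_iff_exists_int]
    refine ⟨m + r + d, ?_⟩
    push_cast
    field_simp
    ring
  have hcadd : ∀ m n, c (m + n) = c m * c n * (ω ^ m) ^ n := by
    intro m n
    simp only [hc]
    rw [hω, ← pow_mul, ← Complex.exp_nat_mul, ← Complex.exp_add, ← Complex.exp_add]
    congr 1
    push_cast
    field_simp
    ring
  have hcc : ∀ n, c n * (starRingEnd ℂ) (c n) = 1 := by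
    intro n
    simp only [hc]
    rw [← Complex.exp_conj, ← Complex.exp_add, ← Complex.exp_zero]
    congr 1
    have h2 : (starRingEnd ℂ) 2 = 2 := Complex.conj_ofNat 2
    simp [h2]
    ring
  have hc0 : c 0 = 1 := by simp [hc]
  have hc1 : c 1 = ω ^ r * p := by
    simp only [hc]
    rw [hω, hp, ← Complex.exp_int_mul, ← Complex.exp_add]
    congr 1
    push_cast
    field_simp
    ring
  have hcω : ∀ m, c m * ω ^ m = ω ^ (-r) * (starRingEnd ℂ) p * c (m + 1) := by
    intro m
    rw [hcadd, hc1, pow_one]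
    have h1 : ω ^ (-r) * ω ^ r = 1 := by rw [← zpow_add₀ hω0]; simp
    linear_combination (-(c m * ω ^ m)) * ((starRingEnd ℂ) p * p * h1 + hpc)
  set S : Matrix ι ι ℂ := ∑ m ∈ Finset.range d, c m • Λ ^ m with hS
  have hU' : U = ((Real.sqrt d : ℂ))⁻¹ • S := hU
  have hfper : ∀ m, c (m + d) • Λ ^ (m + d) = c m • Λ ^ m := by
    intro m; rw [hcper, pow_add, hΛd, mul_one]
  have hpw : ∀ n, Λ ^ n * Λᴴ ^ n = 1 := by
    intro n
    have hcm : Commute Λ Λᴴ := by rw [Commute, SemiconjBy, hLL, hLL']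
    rw [← hcm.mul_pow, hLL', one_pow]
  have hSn : ∀ n, S * Λᴴ ^ n = ∑ m ∈ Finset.range d, c (m + n) • Λ ^ m := by
    intro n
    rw [hS, ← aux_shift (fun m => c m • Λ ^ m) d hfper n, Finset.sum_mul]
    refine Finset.sum_congr rfl fun m _ => ?_
    rw [smul_mul_assoc, pow_add, mul_assoc, hpw, mul_one]
  have hSS : S * Sᴴ = (d : ℂ) • (1 : Matrix ι ι ℂ) := by
    have hSH : Sᴴ = ∑ n ∈ Finset.range d, (starRingEnd ℂ) (c n) • Λᴴ ^ n := by
      rw [hS, conjTranspose_sum]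
      refine Finset.sum_congr rfl fun n _ => ?_
      rw [conjTranspose_smul, conjTranspose_pow]; rfl
    rw [hSH, Finset.mul_sum]
    simp only [mul_smul_comm, hSn, Finset.smul_sum, smul_smul]
    rw [Finset.sum_comm]
    have key : ∀ m ∈ Finset.range d, ∑ n ∈ Finset.range d,
        ((starRingEnd ℂ) (c n) * c (m + n)) • Λ ^ m =
        if m = 0 then (d : ℂ) • (1 : Matrix ι ι ℂ) else 0 := by
      intro m hm
      rw [← Finset.sum_smul]
      have h1 : ∑ n ∈ Finset.range d, (starRingEnd ℂ) (c n) * c (m + n) =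
          c m * ∑ n ∈ Finset.range d, (ω ^ m) ^ n := by
        rw [Finset.mul_sum]
        refine Finset.sum_congr rfl fun n _ => ?_
        rw [hcadd]
        linear_combination (c m * (ω ^ m) ^ n) * hcc n
      rw [h1]
      split_ifs with h0
      · subst h0; simp [hc0]
      · have hne : ω ^ m ≠ 1 := hprim.pow_ne_one_of_pos_of_lt h0 (Finset.mem_range.mp hm)
        have : ∑ n ∈ Finset.range d, (ω ^ m) ^ n = 0 := by
          rw [geom_sum_eq hne, ← pow_mul, mul_comm m, pow_mul, hprim.pow_eq_one]
          simp
        rw [this]; simp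
    rw [Finset.sum_congr rfl key, Finset.sum_ite_eq' (Finset.range d) 0]
    rw [if_pos (Finset.mem_range.mpr (by omega))]
  have hUU : U * Uᴴ = 1 := by
    have hs : ((Real.sqrt d : ℝ) : ℂ) * (Real.sqrt d : ℝ) = d := by
      rw [← Complex.ofReal_mul, Real.mul_self_sqrt (Nat.cast_nonneg d)]; simp
    rw [hU', conjTranspose_smul, smul_mul_smul_comm, hSS, smul_smul]
    have : (((Real.sqrt d : ℝ) : ℂ))⁻¹ * star (((Real.sqrt d : ℝ) : ℂ))⁻¹ * d = 1 := by
      rw [star_inv₀, ← starRingEnd_apply, Complex.conj_ofReal, ← mul_inv, hs, inv_mul_cancel₀ hd0]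
    rw [this, one_smul]
  -- the common conjugation computation
  have hconj : ∀ y : Matrix ι ι ℂ, Λ * y = ω • (y * Λ) →
      U * y * Uᴴ = (ω ^ (-r) * (starRingEnd ℂ) p) • (y * Λᴴ) := by
    intro y hy
    have h1 : S * y = (ω ^ (-r) * (starRingEnd ℂ) p) • (y * Λᴴ * S) := by
      have h2 : S = ∑ m ∈ Finset.range d, c (m + 1) • Λ ^ (m + 1) :=
        (aux_shift (fun m => c m • Λ ^ m) d hfper 1).symm
      conv_rhs => rw [h2]
      rw [hS, Finset.sum_mul, Finset.mul_sum, Finset.smul_sum]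
      refine Finset.sum_congr rfl fun m _ => ?_
      rw [smul_mul_assoc, aux_comm ω Λ y hy, smul_smul, hcω, mul_smul_comm, smul_smul, pow_succ' Λ,
        mul_assoc y, ← mul_assoc Λᴴ, hLL, one_mul]
    have h3 : U * y = (ω ^ (-r) * (starRingEnd ℂ) p) • (y * Λᴴ * U) := by
      rw [hU', smul_mul_assoc, h1, mul_smul_comm, smul_comm]
    rw [h3, smul_mul_assoc, mul_assoc _ U, hUU, mul_one]
  refine ⟨⟨hUU, mul_eq_one_comm.mp hUU⟩, ?_, ?_⟩
  · rw [hconj a, hΛH, hba2]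
    · simp only [mul_smul_comm, smul_smul]
      rw [← mul_assoc a, ha1, one_mul]
      congr 1
      linear_combination ω ^ (-r) * hp2
    · rw [hΛ, smul_mul_assoc, mul_smul_comm, mul_assoc, hba, mul_smul_comm, smul_comm]
  · rw [hconj b, hΛH, hba2]
    · simp only [mul_smul_comm, smul_smul]
      rw [← mul_assoc b, hba2, smul_mul_assoc, smul_smul, mul_assoc aᴴ, ← pow_two]
      congr 1
      rw [sub_eq_add_neg, zpow_add₀ hω0, zpow_one]
      linear_combination ω * ω ^ (-r) * hp2
    · rw [hΛ, smul_mul_assoc, mul_smul_comm, mul_assoc, hb2, mul_one, smul_comm, ← mul_assoc,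
        ← smul_mul_assoc ω, ← hab, mul_assoc, hb1, mul_one]
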